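/- arXiv:2012.00162 — 3 statements merged into one kernel-verified Lean document; each statement's English description precedes it below -/
import Mathlib

section
/- Let f : ℝ² → ℝ be any function and let E = {x ∈ ℝ² : f is Lipschitz at x in residually many directions}. Then the set F = {x ∈ E : f is not Lipschitz at x relative to E} is σ-porous. -/
open Metric MeasureTheory Filter Set

noncomputable section

/-- The Euclidean plane. -/
abbrev E2 := EuclideanSpace ℝ (Fin 2)

/-- `f` is Lipschitz at `x` in direction `u`:
`limsup_{h→0+} |f(x+hu)−f(x)|/h < ∞`, i.e. the quotient is eventually bounded above. -/
def LipAtInDir (f : E2 → ℝ) (x u : E2) : Prop :=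
  Filter.IsBoundedUnder (· ≤ ·) (nhdsWithin (0 : ℝ) (Set.Ioi 0))
    (fun h : ℝ => |f (x + h • u) - f x| / h)

/-- `f` is Lipschitz at `x` in residually many directions: the set of unit directions in which
it fails to be Lipschitz at `x` is of the first Baire category in the unit circle. -/
def LipResidualDirs (f : E2 → ℝ) (x : E2) : Prop :=
  IsMeagre {u : (Metric.sphere (0 : E2) 1) | ¬ LipAtInDir f x (u : E2)}

/-- `f` is Lipschitz at `x` relative to `M`: either `x` is not a limit point of `M`, or
`limsup_{y→x, y∈M} |f(y)−f(x)|/‖y−x‖ < ∞`. -/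
def LipAtRel (f : E2 → ℝ) (x : E2) (M : Set E2) : Prop :=
  x ∉ closure (M \ {x}) ∨
  Filter.IsBoundedUnder (· ≤ ·) (nhdsWithin x (M \ {x}))
    (fun y : E2 => |f y - f x| / ‖y - x‖)

/-- `A` is porous at `x`. -/
def IsPorousAt (A : Set E2) (x : E2) : Prop :=
  ∃ p : ℝ, 0 < p ∧ p < 1 ∧ ∀ ε > 0, ∃ y : E2,
    y ∈ Metric.ball x ε ∧ y ≠ x ∧ Metric.ball y (p * ‖x - y‖) ∩ A = ∅

/-- `A` is porous: porous at each of its points. -/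
def IsPorousSet (A : Set E2) : Prop := ∀ x ∈ A, IsPorousAt A x

/-- `A` is σ-porous: a countable union of porous sets. -/
def IsSigmaPorous (A : Set E2) : Prop :=
  ∃ s : ℕ → Set E2, (∀ n, IsPorousSet (s n)) ∧ A = ⋃ n, s n

/-- `w` is an `N`-good direction (not necessarily a unit vector) at `z`. -/
def GoodDir (f : E2 → ℝ) (N : ℕ) (z w : E2) : Prop :=
  ∀ s : ℝ, 0 < s → s * ‖w‖ * (N + 1) < 1 → |f (z + s • w) - f z| ≤ (N + 1) * (s * ‖w‖)

/-- good directions of `z` are dense in the ball around `e` of radius `δ`. -/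
def DenseGood (f : E2 → ℝ) (N : ℕ) (e : E2) (δ : ℝ) (z : E2) : Prop :=
  ∀ d : E2, ‖d - e‖ < δ → d ∈ closure {w | GoodDir f N z w}

lemma goodDir_smul {f : E2 → ℝ} {N : ℕ} {z w : E2} (h : GoodDir f N z w) {c : ℝ} (hc : 0 < c) :
    GoodDir f N z (c • w) := by
  intro s hs hs1
  rw [norm_smul, Real.norm_of_nonneg hc.le] at *
  have := h (s * c) (by positivity) (by linarith)
  rw [smul_smul]
  linarith

instance : Nonempty (Metric.sphere (0 : E2) 1) :=
  ⟨⟨EuclideanSpace.single 0 1, by simp⟩⟩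

instance : BaireSpace (Metric.sphere (0 : E2) 1) := by
  haveI : CompleteSpace (Metric.sphere (0 : E2) 1) :=
    (Metric.isClosed_sphere).completeSpace_coe
  infer_instance

/-- The cross product in the plane. -/
def crs (a b : E2) : ℝ := a 0 * b 1 - a 1 * b 0

lemma crs_cont (a : E2) : Continuous (fun w : E2 => crs a w) := by
  unfold crs; fun_prop

lemma exists_dir {f : E2 → ℝ} {y d : E2} (hy : LipResidualDirs f y) (hd : d ≠ 0) :
    ∃ u : E2, ‖u‖ = 1 ∧ LipAtInDir f y u ∧ crs d u ≠ 0 := by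
  have hres : {u : (Metric.sphere (0 : E2) 1) | LipAtInDir f y (u : E2)} ∈
      residual (Metric.sphere (0 : E2) 1) := by
    have h := hy
    unfold LipResidualDirs IsMeagre at h
    convert h using 1
    ext u; simp
  have hdense := dense_of_mem_residual hres
  have hop : IsOpen {u : (Metric.sphere (0 : E2) 1) | crs d (u : E2) ≠ 0} :=
    isOpen_ne_fun ((crs_cont d).comp continuous_subtype_val) continuous_const
  have hpos : 0 < d 0 ^ 2 + d 1 ^ 2 := by
    have : 0 < ‖d‖ ^ 2 := by positivity
    rwa [EuclideanSpace.norm_sq_eq, Fin.sum_univ_two, Real.norm_eq_abs, Real.norm_eq_abs,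
      sq_abs, sq_abs] at this
  have hne : {u : (Metric.sphere (0 : E2) 1) | crs d (u : E2) ≠ 0}.Nonempty := by
    set v : E2 := !₂[-d 1, d 0] with hv
    have hc : crs d v = d 0 ^ 2 + d 1 ^ 2 := by simp [crs, hv]; ring
    have hv0 : v ≠ 0 := by
      intro h0
      rw [h0] at hc
      simp [crs] at hc
      linarith
    have hvn : 0 < ‖v‖ := norm_pos_iff.2 hv0
    refine ⟨⟨‖v‖⁻¹ • v, ?_⟩, ?_⟩
    · simp [norm_smul, hvn.ne']
    · have : crs d (‖v‖⁻¹ • v) = ‖v‖⁻¹ * crs d v := by simp [crs]; ring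
      simp only [mem_setOf_eq]
      rw [this, hc]
      positivity
  obtain ⟨u, hu1, hu2⟩ := hdense.inter_open_nonempty _ hop hne
  exact ⟨u, by simpa using u.2, hu2, hu1⟩

lemma cross_point {f : E2 → ℝ} {N : ℕ} {e z d u : E2} {δ t : ℝ} (hz : DenseGood f N e δ z)
    (hd : ‖d - e‖ < δ) (ht : 0 < t) (hs : t * ‖d‖ * (N + 1) < 1) (hu : ‖u‖ = 1)
    (hdu : crs d u ≠ 0) {η : ℝ} (hη : 0 < η) :
    ∃ h, 0 < h ∧ h < η ∧ |f (z + t • (d + h • u)) - f z| ≤ (N + 1) * (t * (‖d‖ + h)) := by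
  -- shrink `η`
  obtain ⟨η', hη', hηη, hηδ, hηs⟩ : ∃ η' > 0, η' ≤ η ∧ ‖d - e‖ + η' ≤ δ ∧
      t * (‖d‖ + η') * (N + 1) ≤ 1 := by
    have hN : (0 : ℝ) < N + 1 := by positivity
    refine ⟨min η (min (δ - ‖d - e‖) ((1 - t * ‖d‖ * (N + 1)) / (t * (N + 1)))), ?_, ?_, ?_, ?_⟩
    · refine lt_min hη (lt_min (by linarith) (div_pos (by linarith) (by positivity)))
    · exact min_le_left _ _
    · have := (min_le_right η (min (δ - ‖d - e‖) ((1 - t * ‖d‖ * (N + 1)) / (t * (N + 1))))).trans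
        (min_le_left _ _)
      linarith
    · have := (min_le_right η (min (δ - ‖d - e‖) ((1 - t * ‖d‖ * (N + 1)) / (t * (N + 1))))).trans
        (min_le_right _ _)
      rw [le_div_iff₀ (by positivity)] at this
      linarith
  set d0 : E2 := d + (η' / 2) • u with hd0
  have hd0e : ‖d0 - e‖ < δ := by
    have : d0 - e = (d - e) + (η' / 2) • u := by rw [hd0]; abel
    rw [this]
    refine (norm_add_le _ _).trans_lt ?_
    rw [norm_smul, hu, Real.norm_of_nonneg (by positivity)]
    linarith
  have hmem := hz d0 hd0e
  have hc0 : crs u d0 = - crs d u := by simp [crs, hd0]; ring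
  have hc1 : crs d d0 = η' / 2 * crs d u := by simp [crs, hd0]; ring
  have hne : crs u d0 ≠ 0 := by rw [hc0]; exact neg_ne_zero.2 hdu
  have hcont1 : ContinuousAt (fun w : E2 => - crs d w / crs u w) d0 :=
    ((crs_cont d).neg.continuousAt).div (crs_cont u).continuousAt hne
  have hcont2 : ContinuousAt (fun w : E2 => - crs d u / crs u w) d0 :=
    continuousAt_const.div (crs_cont u).continuousAt hne
  have hv1 : - crs d d0 / crs u d0 = η' / 2 := by
    rw [hc0, hc1]; field_simp
  have hv2 : - crs d u / crs u d0 = 1 := by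
    rw [hc0]; field_simp
  have ev1 : ∀ᶠ w in nhds d0, - crs d w / crs u w ∈ Ioo 0 η' :=
    hcont1.eventually_mem (by rw [hv1]; exact Ioo_mem_nhds (by linarith) (by linarith))
  have ev2 : ∀ᶠ w in nhds d0, - crs d u / crs u w ∈ Ioi 0 :=
    hcont2.eventually_mem (by rw [hv2]; exact Ioi_mem_nhds (by linarith))
  have ev3 : ∀ᶠ w in nhds d0, crs u w ∈ ({0}ᶜ : Set ℝ) :=
    (crs_cont u).continuousAt.eventually_mem (isOpen_compl_singleton.mem_nhds hne)
  obtain ⟨w, hw, ⟨hh0, hh1⟩, ha, hcw⟩ :=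
    ((mem_closure_iff_frequently.1 hmem).and_eventually (ev1.and (ev2.and ev3))).exists
  simp only [mem_Ioi, mem_compl_iff, mem_singleton_iff] at ha hcw
  set h := - crs d w / crs u w with hh
  set a := - crs d u / crs u w with haa
  have key : d + h • u = a • w := by
    have e1 : h * crs u w = - crs d w := div_mul_cancel₀ _ hcw
    have e2 : a * crs u w = - crs d u := div_mul_cancel₀ _ hcw
    ext i
    apply mul_right_cancel₀ hcw
    clear_value h a
    clear hcw
    fin_cases i
    · simp only [Fin.zero_eta, PiLp.add_apply, PiLp.smul_apply, smul_eq_mul]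
      have e3 : (d 0 + h * u 0) * crs u w = d 0 * crs u w + u 0 * (h * crs u w) := by ring
      have e4 : a * w 0 * crs u w = w 0 * (a * crs u w) := by ring
      refine e3.trans (Eq.trans ?_ e4.symm)
      rw [e1, e2]
      simp only [crs]
      ring
    · simp only [Fin.mk_one, PiLp.add_apply, PiLp.smul_apply, smul_eq_mul]
      have e3 : (d 1 + h * u 1) * crs u w = d 1 * crs u w + u 1 * (h * crs u w) := by ring
      have e4 : a * w 1 * crs u w = w 1 * (a * crs u w) := by ring
      refine e3.trans (Eq.trans ?_ e4.symm)
      rw [e1, e2]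
      simp only [crs]
      ring
  have hg := goodDir_smul hw ha
  rw [← key] at hg
  have hnorm : ‖d + h • u‖ ≤ ‖d‖ + h := by
    refine (norm_add_le _ _).trans_eq ?_
    rw [norm_smul, hu, Real.norm_of_nonneg hh0.le, mul_one]
  have hN : (0 : ℝ) < N + 1 := by positivity
  refine ⟨h, hh0, hh1.trans_le hηη, (hg t ht ?_).trans ?_⟩
  · calc t * ‖d + h • u‖ * (N + 1) ≤ t * (‖d‖ + h) * (N + 1) := by gcongr
      _ < t * (‖d‖ + η') * (N + 1) := by gcongr
      _ ≤ 1 := hηs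
  · gcongr

lemma key_bound {f : E2 → ℝ} {N : ℕ} {e z d : E2} {δ t : ℝ} (hz : DenseGood f N e δ z)
    (hd : ‖d - e‖ < δ) (hd0 : d ≠ 0) (ht : 0 < t) (hs : t * ‖d‖ * (N + 1) < 1)
    (hy : LipResidualDirs f (z + t • d)) :
    |f (z + t • d) - f z| ≤ (N + 1) * (t * ‖d‖) := by
  obtain ⟨u, hu, hlip, hdu⟩ := exists_dir hy hd0
  obtain ⟨M, hM⟩ := hlip
  rw [eventually_map, eventually_nhdsWithin_iff, Metric.eventually_nhds_iff] at hM
  obtain ⟨ρ, hρ, hM⟩ := hM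
  have hM' : ∀ h, 0 < h → h < ρ → |f (z + t • d + h • u) - f (z + t • d)| ≤ (|M| + 1) * h := by
    intro h h0 h1
    have := hM (y := h) (by rw [Real.dist_eq, sub_zero, abs_of_pos h0]; exact h1) h0
    beta_reduce at this
    rw [div_le_iff₀ h0] at this
    refine this.trans ?_
    gcongr
    linarith [le_abs_self M]
  have hMp : 0 < |M| + 1 := by positivity
  have hN : (0 : ℝ) < N + 1 := by positivity
  refine le_of_forall_pos_le_add fun ε hε => ?_
  have hC : 0 < (|M| + 1) * t + (N + 1) * t := by positivity
  obtain ⟨h, h0, h1, h2⟩ := cross_point hz hd ht hs hu hdu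
    (η := min (ρ / t) (ε / ((|M| + 1) * t + (N + 1) * t)))
    (lt_min (by positivity) (by positivity))
  have h3 := h1.trans_le (min_le_left _ _)
  have h4 := h1.trans_le (min_le_right _ _)
  rw [lt_div_iff₀ ht] at h3
  rw [lt_div_iff₀ hC] at h4
  have h5 := hM' (h * t) (by positivity) h3
  have h6 : z + t • d + (h * t) • u = z + t • (d + h • u) := by
    rw [smul_add, smul_smul, mul_comm h t, add_assoc]
  rw [h6] at h5
  have h7 := abs_sub_le (f (z + t • d)) (f (z + t • (d + h • u))) (f z)
  rw [abs_sub_comm (f (z + t • d)) (f (z + t • (d + h • u)))] at h7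
  nlinarith

lemma exists_denseGood {f : E2 → ℝ} {x : E2} (hx : LipResidualDirs f x) :
    ∃ N i K : ℕ, DenseGood f N
      (TopologicalSpace.denseSeq (Metric.sphere (0 : E2) 1) i : E2) (1 / ((K : ℝ) + 2)) x := by
  set A : ℕ → Set (Metric.sphere (0 : E2) 1) := fun N => {u | GoodDir f N x u} with hA
  have hcover : ∀ u : (Metric.sphere (0 : E2) 1), LipAtInDir f x (u : E2) → ∃ N, u ∈ A N := by
    intro u hlip
    have hu : ‖(u : E2)‖ = 1 := by simpa using u.2
    obtain ⟨M, hM⟩ := hlip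
    rw [eventually_map, eventually_nhdsWithin_iff, Metric.eventually_nhds_iff] at hM
    obtain ⟨ρ, hρ, hM⟩ := hM
    obtain ⟨N, hN⟩ := exists_nat_gt (max M (1 / ρ))
    have hN1 : M < N := (le_max_left _ _).trans_lt hN
    have hN2 : 1 / ρ < N := (le_max_right _ _).trans_lt hN
    refine ⟨N, ?_⟩
    intro s hs hs1
    rw [hu, mul_one] at hs1 ⊢
    rw [div_lt_iff₀ hρ] at hN2
    have hsρ : s < ρ := by
      by_contra hcon
      push Not at hcon
      have : (N : ℝ) * ρ ≤ N * s := by gcongr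
      nlinarith
    have := hM (y := s) (by rw [Real.dist_eq, sub_zero, abs_of_pos hs]; exact hsρ) hs
    beta_reduce at this
    rw [div_le_iff₀ hs] at this
    refine this.trans ?_
    gcongr
    linarith
  have hex : ∃ N, (interior (closure (A N))).Nonempty := by
    by_contra hcon
    push Not at hcon
    have hm : IsMeagre (⋃ N, A N) := isMeagre_iUnion fun N => IsNowhereDense.isMeagre (hcon N)
    have hm2 := hm.union hx
    have huniv : (⋃ N, A N) ∪ {u : (Metric.sphere (0 : E2) 1) | ¬ LipAtInDir f x (u : E2)}
        = univ := by
      ext u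
      simp only [mem_union, mem_iUnion, mem_setOf_eq, mem_univ, iff_true]
      by_cases h : LipAtInDir f x (u : E2)
      · exact Or.inl (hcover u h)
      · exact Or.inr h
    rw [huniv] at hm2
    have := dense_of_mem_residual hm2
    simpa using this.nonempty
  obtain ⟨N, hN⟩ := hex
  obtain ⟨e, he, i, rfl⟩ := (TopologicalSpace.denseRange_denseSeq
    (Metric.sphere (0 : E2) 1)).inter_open_nonempty _ isOpen_interior hN
  set e := TopologicalSpace.denseSeq (Metric.sphere (0 : E2) 1) i with hedef
  have hen : ‖(e : E2)‖ = 1 := by simpa using e.2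
  obtain ⟨ρ, hρ, hball⟩ := Metric.isOpen_iff.1 isOpen_interior e he
  obtain ⟨K, hK⟩ := exists_nat_gt (2 / ρ)
  refine ⟨N, i, K, ?_⟩
  intro d hd
  have hK2 : 2 * (1 / ((K : ℝ) + 2)) < ρ := by
    rw [div_lt_iff₀ hρ] at hK
    rw [mul_one_div, div_lt_iff₀ (by positivity)]
    nlinarith
  have hK1 : 1 / ((K : ℝ) + 2) ≤ 1 / 2 := by
    apply one_div_le_one_div_of_le (by norm_num)
    have : (0 : ℝ) ≤ K := by positivity
    linarith
  have habs : |‖d‖ - 1| ≤ ‖d - e‖ := by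
    have := abs_norm_sub_norm_le d (e : E2)
    rwa [hen] at this
  have hdpos : 0 < ‖d‖ := by
    have := (abs_le.1 habs).1
    linarith
  set v : (Metric.sphere (0 : E2) 1) := ⟨‖d‖⁻¹ • d, by simp [norm_smul, hdpos.ne']⟩ with hv
  have hdv : d = ‖d‖ • (v : E2) := by
    rw [hv]; simp only [smul_smul]; rw [mul_inv_cancel₀ hdpos.ne', one_smul]
  have hvn : ‖(v : E2)‖ = 1 := by simpa using v.2
  have hvd : ‖(v : E2) - d‖ ≤ ‖d - e‖ := by
    have h1 : (v : E2) - d = (1 - ‖d‖) • (v : E2) := by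
      rw [sub_smul, one_smul, ← hdv]
    rw [h1, norm_smul, hvn, mul_one, Real.norm_eq_abs, abs_sub_comm]
    exact habs
  have hvball : v ∈ Metric.ball e ρ := by
    rw [Metric.mem_ball, Subtype.dist_eq, dist_eq_norm]
    have := norm_sub_le_norm_sub_add_norm_sub (v : E2) d e
    linarith
  have hvcl : v ∈ closure (A N) := interior_subset (hball hvball)
  rw [Metric.mem_closure_iff] at hvcl ⊢
  intro ε hε
  obtain ⟨w, hw, hvw⟩ := hvcl (ε / ‖d‖) (by positivity)
  refine ⟨‖d‖ • (w : E2), goodDir_smul hw hdpos, ?_⟩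
  rw [Subtype.dist_eq, lt_div_iff₀ hdpos, dist_eq_norm] at hvw
  rw [dist_eq_norm]
  calc ‖d - ‖d‖ • (w : E2)‖ = ‖‖d‖ • ((v : E2) - w)‖ := by rw [smul_sub, ← hdv]
    _ = ‖(v : E2) - w‖ * ‖d‖ := by rw [norm_smul, norm_norm, mul_comm]
    _ < ε := hvw

lemma porous_piece (f : E2 → ℝ) (N : ℕ) (e : E2) (he : ‖e‖ = 1) (δ : ℝ) (hδ : 0 < δ)
    (hδ1 : δ ≤ 1 / 2) :
    IsPorousSet {x : E2 | (LipResidualDirs f x ∧ ¬ LipAtRel f x {x' : E2 | LipResidualDirs f x'}) ∧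
      DenseGood f N e δ x} := by
  rintro x ⟨⟨hxE, hxF⟩, hxD⟩
  set S := {x : E2 | (LipResidualDirs f x ∧ ¬ LipAtRel f x {x' : E2 | LipResidualDirs f x'}) ∧
      DenseGood f N e δ x} with hS
  by_contra hpor
  apply hxF
  right
  unfold IsPorousAt at hpor
  push Not at hpor
  obtain ⟨ε, hε, hpor⟩ := hpor (δ / 4) (by positivity) (by linarith)
  have hN : (0 : ℝ) < N + 1 := by positivity
  refine ⟨(N + 1) * (16 / δ), ?_⟩
  rw [eventually_map, eventually_nhdsWithin_iff, Metric.eventually_nhds_iff]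
  refine ⟨δ / 4 * min ε (1 / (2 * (N + 1))), by positivity, ?_⟩
  rintro y hy ⟨hyE, hyx⟩
  have hyx' : y ≠ x := hyx
  have hr : 0 < ‖y - x‖ := norm_pos_iff.2 (sub_ne_zero.2 hyx')
  rw [dist_eq_norm] at hy
  rw [div_le_iff₀ hr]
  set R := 4 / δ * ‖y - x‖ with hR
  have hRpos : 0 < R := by positivity
  have hrR : ‖y - x‖ = δ / 4 * R := by rw [hR]; field_simp
  have hRm : R < min ε (1 / (2 * (N + 1))) := by
    rw [hrR] at hy
    exact lt_of_mul_lt_mul_left hy (by positivity)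
  have hRε := hRm.trans_le (min_le_left _ _)
  have hRN := hRm.trans_le (min_le_right _ _)
  rw [lt_div_iff₀ (by positivity)] at hRN
  have hxw : ‖x - (x - R • e)‖ = R := by
    rw [sub_sub_cancel, norm_smul, he, Real.norm_of_nonneg hRpos.le, mul_one]
  obtain ⟨z, hz, hzS⟩ := hpor (x - R • e) (by
      rw [Metric.mem_ball, dist_comm, dist_eq_norm, hxw]; exact hRε) (by
      intro h
      rw [h, sub_self, norm_zero] at hxw
      linarith)
  rw [hxw, Metric.mem_ball, dist_comm, dist_eq_norm] at hz
  have hzD := hzS.2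
  have aux : ∀ q : E2, LipResidualDirs f q → ‖q - x‖ ≤ δ / 4 * R →
      |f q - f z| ≤ (N + 1) * (2 * R) := by
    intro q hq hqx
    set d : E2 := R⁻¹ • (q - z) with hd
    have hqz : q = z + R • d := by
      rw [hd, smul_smul, mul_inv_cancel₀ hRpos.ne', one_smul]; abel
    have hde : ‖d - e‖ < δ := by
      have h1 : d - e = R⁻¹ • ((x - R • e - z) + (q - x)) := by
        have : e = R⁻¹ • (R • e) := by rw [smul_smul, inv_mul_cancel₀ hRpos.ne', one_smul]
        rw [hd]
        nth_rewrite 1 [this]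
        rw [← smul_sub]
        congr 1
        abel
      rw [h1, norm_smul, norm_inv, Real.norm_of_nonneg hRpos.le, inv_mul_lt_iff₀ hRpos]
      refine (norm_add_le _ _).trans_lt ?_
      nlinarith
    have h2 := abs_norm_sub_norm_le d e
    rw [he] at h2
    have h3 := abs_le.1 h2
    have hd2 : ‖d‖ ≤ 2 := by linarith
    have hd0 : d ≠ 0 := by
      intro h0
      rw [h0, norm_zero] at h3
      rw [h0] at hde
      linarith [h3.1]
    have h4 : R * ‖d‖ ≤ 2 * R := by nlinarith
    have := key_bound hzD hde hd0 hRpos (by nlinarith) (hqz ▸ hq)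
    rw [← hqz] at this
    exact this.trans (by gcongr)
  have b1 := aux x hxE (by simp; positivity)
  have b2 := aux y hyE hrR.le
  have b3 := abs_sub_le (f y) (f z) (f x)
  rw [abs_sub_comm (f z) (f x)] at b3
  have : (N + 1) * (16 / δ) * ‖y - x‖ = ((N : ℝ) + 1) * (4 * R) := by rw [hR]; ring
  rw [this]
  linarith

/-- If `E` is the set of points at which `f` is Lipschitz in residually many directions, then the
set of points of `E` at which `f` is not Lipschitz relative to `E` is σ-porous. -/
theorem stmt0 (f : E2 → ℝ) :
    IsSigmaPorous {x : E2 | x ∈ {x' : E2 | LipResidualDirs f x'} ∧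
      ¬ LipAtRel f x {x' : E2 | LipResidualDirs f x'}} := by
  obtain ⟨g, hg⟩ := exists_surjective_nat (ℕ × ℕ × ℕ)
  refine ⟨fun n => {x : E2 | (LipResidualDirs f x ∧
    ¬ LipAtRel f x {x' : E2 | LipResidualDirs f x'}) ∧
      DenseGood f (g n).1 (TopologicalSpace.denseSeq (Metric.sphere (0 : E2) 1) (g n).2.1 : E2)
        (1 / (((g n).2.2 : ℝ) + 2)) x}, ?_, ?_⟩
  · intro n
    apply porous_piece
    · simpa using (TopologicalSpace.denseSeq (Metric.sphere (0 : E2) 1) (g n).2.1).2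
    · positivity
    · apply one_div_le_one_div_of_le (by norm_num)
      have : (0 : ℝ) ≤ ((g n).2.2 : ℝ) := by positivity
      linarith
  · ext x
    simp only [mem_setOf_eq, mem_iUnion]
    constructor
    · intro h
      obtain ⟨N, i, K, hD⟩ := exists_denseGood h.1
      obtain ⟨n, hn⟩ := hg (N, i, K)
      exact ⟨n, h, by rw [hn]; exact hD⟩
    · rintro ⟨n, h, -⟩
      exact h
end
end

section
/- Let f : ℝ² → ℝ be any function and let E = {x ∈ ℝ² : f is Lipschitz at x in every direction u ∈ S¹}. Then the set F = {x ∈ E : f is not Lipschitz at x relative to E} has Lebesgue measure zero. -/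
open Metric MeasureTheory Filter Set

noncomputable section

/-- The set of points at which `f` is Lipschitz in every direction. -/
def goodSet (f : E2 → ℝ) : Set E2 :=
  {x' : E2 | ∀ u ∈ Metric.sphere (0 : E2) 1, LipAtInDir f x' u}

/-- Points of the good set at which `f` is uniformly Lipschitz relative to the good set in the
open cone of directions spanned by `O`. -/
def coneSet (f : E2 → ℝ) (O : Set E2) (N : ℕ) : Set E2 :=
  {x : E2 | x ∈ goodSet f ∧ ∀ v ∈ O, ∀ s : ℝ, 0 < s → x + s • v ∈ goodSet f →
    s * ‖v‖ < 1 / ((N : ℝ) + 1) → |f (x + s • v) - f x| ≤ ((N : ℝ) + 1) * (s * ‖v‖)}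

lemma lipDir_bound {f : E2 → ℝ} {x u : E2} (h : LipAtInDir f x u) :
    ∃ C δ : ℝ, 0 ≤ C ∧ 0 < δ ∧ ∀ t, 0 < t → t < δ → |f (x + t • u) - f x| ≤ C * t := by
  obtain ⟨C, hC⟩ := h
  rw [Filter.eventually_map, eventually_nhdsWithin_iff, Metric.eventually_nhds_iff] at hC
  obtain ⟨δ, hδ, hC⟩ := hC
  refine ⟨max C 0, δ, le_max_right _ _, hδ, fun t ht0 ht => ?_⟩
  have h1 := hC (y := t) (by simpa [abs_of_pos ht0] using ht) ht0
  have h1 := (div_le_iff₀ ht0).1 h1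
  exact h1.trans (mul_le_mul_of_nonneg_right (le_max_left _ _) ht0.le)

/-- The planar rotation by a right angle. -/
def rot (d : E2) : E2 := !₂[-d 1, d 0]

lemma norm_rot (d : E2) : ‖rot d‖ = ‖d‖ := by
  simp [EuclideanSpace.norm_eq, rot, add_comm]

lemma inner_formula (a b : E2) : inner ℝ a b = a 0 * b 0 + a 1 * b 1 := by
  simp [PiLp.inner_apply, Fin.sum_univ_two, mul_comm]

lemma decomp (u d : E2) :
    (inner ℝ d d : ℝ) • u = (inner ℝ u d : ℝ) • d + (inner ℝ u (rot d) : ℝ) • rot d := by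
  rw [inner_formula d d]
  ext i
  fin_cases i <;> simp [inner_formula, rot] <;> ring

/-- The directions in which `f` has a large difference quotient at `x` at a small scale. -/
def badDir (f : E2 → ℝ) (x : E2) (N : ℕ) : Set E2 :=
  {u : E2 | ∃ h : ℝ, 0 < h ∧ h * ‖u‖ < 1 / ((N : ℝ) + 1) ∧
    ((N : ℝ) + 1) * (h * ‖u‖) < |f (x + h • u) - f x|}

lemma bad_open {f : E2 → ℝ} {x v : E2} {N : ℕ} {s : ℝ} (hs : 0 < s)
    (hy : x + s • v ∈ goodSet f) (hsm : s * ‖v‖ < 1 / ((N : ℝ) + 1))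
    (hbad : ((N : ℝ) + 1) * (s * ‖v‖) < |f (x + s • v) - f x|) :
    v ∈ closure (interior (badDir f x N)) := by
  have hv : v ≠ 0 := by
    rintro rfl
    simp at hbad
  have hvn : 0 < ‖v‖ := norm_pos_iff.2 hv
  set w : E2 := (‖v‖⁻¹) • rot v with hw
  have hwn : ‖w‖ = 1 := by
    rw [hw, norm_smul, norm_rot, norm_inv, norm_norm, inv_mul_cancel₀ hvn.ne']
  obtain ⟨C, δ, hC0, hδ, hC⟩ := lipDir_bound (hy w (by simpa using hwn))
  -- the conditions hold for all small positive parameters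
  have hcont1 : Tendsto (fun t : ℝ => s * ‖v + t • w‖) (nhds 0) (nhds (s * ‖v‖)) := by
    have : Continuous (fun t : ℝ => s * ‖v + t • w‖) := by fun_prop
    simpa using this.tendsto 0
  have hcont2 : Tendsto (fun t : ℝ => ((N : ℝ) + 1) * (s * ‖v + t • w‖) + C * (s * t))
      (nhds 0) (nhds (((N : ℝ) + 1) * (s * ‖v‖))) := by
    have : Continuous (fun t : ℝ => ((N : ℝ) + 1) * (s * ‖v + t • w‖) + C * (s * t)) := by
      fun_prop
    simpa using this.tendsto 0
  have hcont3 : Tendsto (fun t : ℝ => s * t) (nhds 0) (nhds 0) := by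
    have : Continuous (fun t : ℝ => s * t) := by fun_prop
    simpa using this.tendsto 0
  have hev := (hcont1.eventually_lt_const hsm).and
    ((hcont2.eventually_lt_const hbad).and (hcont3.eventually_lt_const hδ))
  rw [Metric.eventually_nhds_iff] at hev
  obtain ⟨η, hη, hev⟩ := hev
  have key : ∀ t : ℝ, 0 < t → t < η → ∀ c : ℝ, 0 < c → c • (v + t • w) ∈ badDir f x N := by
    intro t ht0 htη c hc
    obtain ⟨h1, h2, h3⟩ := hev (y := t) (by simpa [abs_of_pos ht0] using htη)
    have e1 : (s / c) * ‖c • (v + t • w)‖ = s * ‖v + t • w‖ := by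
      rw [norm_smul, Real.norm_of_nonneg hc.le]; field_simp
    have e2 : x + (s / c) • c • (v + t • w) = (x + s • v) + (s * t) • w := by
      rw [smul_smul, div_mul_cancel₀ _ hc.ne', smul_add, smul_smul, add_assoc]
    refine ⟨s / c, by positivity, by rw [e1]; exact h1, ?_⟩
    rw [e1, e2]
    have h4 := hC (s * t) (by positivity) h3
    have h5 := abs_sub_le (f (x + s • v)) (f (x + s • v + (s * t) • w)) (f x)
    rw [abs_sub_comm (f (x + s • v)) (f (x + s • v + (s * t) • w))] at h5
    linarith
  -- the open set of directions
  set U : Set E2 := {u | 0 < (inner ℝ u v : ℝ) ∧ 0 < (inner ℝ u (rot v) : ℝ) ∧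
    ‖v‖ * (inner ℝ u (rot v) : ℝ) < η * (inner ℝ u v : ℝ)} with hU
  have hUo : IsOpen U := by
    have c1 : Continuous (fun u : E2 => (inner ℝ u v : ℝ)) := by fun_prop
    have c2 : Continuous (fun u : E2 => (inner ℝ u (rot v) : ℝ)) := by fun_prop
    exact (isOpen_lt continuous_const c1).inter ((isOpen_lt continuous_const c2).inter
      (isOpen_lt (c2.const_mul ‖v‖) (c1.const_mul η)))
  have hvv : (inner ℝ v v : ℝ) = ‖v‖ ^ 2 := real_inner_self_eq_norm_sq v
  have hUsub : U ⊆ badDir f x N := by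
    rintro u ⟨h1, h2, h3⟩
    have hd := decomp u v
    set a : ℝ := inner ℝ u v
    set b : ℝ := inner ℝ u (rot v)
    have hue : u = (a / ‖v‖ ^ 2) • (v + (‖v‖ * b / a) • w) := by
      have : u = (‖v‖ ^ 2)⁻¹ • ((inner ℝ v v : ℝ) • u) := by
        rw [hvv, smul_smul, inv_mul_cancel₀ (by positivity), one_smul]
      rw [this, hd, hw, smul_add, smul_add, smul_smul, smul_smul, smul_smul, smul_smul]
      congr 2 <;> field_simp
    rw [hue]
    exact key _ (by positivity) (by rw [div_lt_iff₀ h1]; exact h3) _ (by positivity)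
  have hUint : U ⊆ interior (badDir f x N) := interior_maximal hUsub hUo
  have hwv : (inner ℝ w v : ℝ) = 0 := by
    rw [hw, real_inner_smul_left]
    simp [inner_formula, rot]
    right; ring
  have hvr : (inner ℝ v (rot v) : ℝ) = 0 := by
    simp [inner_formula, rot]; ring
  have hwr : (inner ℝ w (rot v) : ℝ) = ‖v‖ := by
    rw [hw, real_inner_smul_left, real_inner_self_eq_norm_sq, norm_rot]
    field_simp
  have hT : Tendsto (fun t : ℝ => v + t • w) (nhdsWithin 0 (Ioi 0)) (nhds v) := by
    have : Continuous (fun t : ℝ => v + t • w) := by fun_prop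
    have h := this.tendsto 0
    simp only [zero_smul, add_zero] at h
    exact h.mono_left nhdsWithin_le_nhds
  refine mem_closure_of_tendsto hT ?_
  filter_upwards [Ioo_mem_nhdsGT hη] with t ht
  apply hUint
  simp only [hU, mem_ofPred_eq, inner_add_left, real_inner_smul_left, hwv, hvr, hwr, hvv]
  have h0 := ht.1
  refine ⟨by positivity, by positivity, ?_⟩
  have := mul_lt_mul_of_pos_right ht.2 (pow_pos hvn 2)
  nlinarith

lemma not_dense {f : E2 → ℝ} {x : E2} (hx : x ∈ goodSet f) :
    ∃ N : ℕ, ¬ Dense (interior (badDir f x N)) := by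
  by_contra! hcon
  have hd : Dense (⋂ N : ℕ, interior (badDir f x N)) :=
    dense_iInter_of_isOpen (fun N => isOpen_interior) hcon
  obtain ⟨u, hu⟩ := hd.nonempty
  have hu : ∀ N, u ∈ badDir f x N := fun N => interior_subset (mem_iInter.1 hu N)
  have hu0 : u ≠ 0 := by
    rintro rfl
    obtain ⟨h, _, _, h3⟩ := hu 0
    simp at h3
  have hun : 0 < ‖u‖ := norm_pos_iff.2 hu0
  obtain ⟨C, δ, hC0, hδ, hC⟩ := lipDir_bound (hx (‖u‖⁻¹ • u) (by
    rw [mem_sphere_zero_iff_norm, norm_smul, norm_inv, norm_norm, inv_mul_cancel₀ hun.ne']))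
  obtain ⟨n1, hn1⟩ := exists_nat_gt C
  obtain ⟨n2, hn2⟩ := exists_nat_one_div_lt hδ
  obtain ⟨h, h1, h2, h3⟩ := hu (max n1 n2)
  have hn1' : (n1 : ℝ) ≤ ((max n1 n2 : ℕ) : ℝ) := by exact_mod_cast le_max_left _ _
  have hn2' : (n2 : ℝ) ≤ ((max n1 n2 : ℕ) : ℝ) := by exact_mod_cast le_max_right _ _
  have hh : 1 / (((max n1 n2 : ℕ) : ℝ) + 1) ≤ 1 / ((n2 : ℝ) + 1) := by
    apply one_div_le_one_div_of_le <;> [positivity; linarith]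
  have h4 := hC (h * ‖u‖) (by positivity) (by linarith)
  rw [smul_smul, mul_assoc, mul_inv_cancel₀ hun.ne', mul_one] at h4
  have : 0 < h * ‖u‖ := by positivity
  nlinarith

lemma goodSet_cover {f : E2 → ℝ} {x : E2} (hx : x ∈ goodSet f) :
    ∃ O ∈ TopologicalSpace.countableBasis E2, ∃ N : ℕ, x ∈ coneSet f O N := by
  obtain ⟨N, hN⟩ := not_dense hx
  rw [Dense] at hN
  push Not at hN
  obtain ⟨v, hv⟩ := hN
  obtain ⟨O, hO, hvO, hOs⟩ := (TopologicalSpace.isBasis_countableBasis E2).exists_subset_of_mem_open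
    (show v ∈ (closure (interior (badDir f x N)))ᶜ from hv) isClosed_closure.isOpen_compl
  refine ⟨O, hO, N, hx, fun v' hv' s hs hy hsm => ?_⟩
  by_contra! hcon
  exact hOs hv' (bad_open hs hy hsm hcon)

lemma null_piece (f : E2 → ℝ) (O : Set E2) (hO : IsOpen O) (hne : O.Nonempty) (N : ℕ) :
    volume (coneSet f O N ∩ {x | ¬ LipAtRel f x (goodSet f)}) = 0 := by
  obtain ⟨v, hv⟩ := hne
  obtain ⟨r, hr, hrO⟩ := Metric.isOpen_iff.1 hO v hv
  set R : ℝ := 3 / r with hR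
  have hRp : 0 < R := by positivity
  set A := coneSet f O N with hA
  have hae := IsUnifLocDoublingMeasure.ae_tendsto_measure_inter_div (volume : Measure E2) A
    (R * ‖v‖)
  rw [ae_iff] at hae
  have hnull := le_antisymm ((Measure.le_restrict_apply _ _).trans hae.le) zero_le
  refine measure_mono_null ?_ hnull
  rintro x ⟨hxA, hxn⟩
  refine ⟨fun hx => hxn ?_, hxA⟩
  have hlim := hx (l := nhdsWithin (0 : ℝ) (Ioi 0)) (fun ρ => x - (R * ρ) • v) (fun ρ => ρ)
    tendsto_id (by
      filter_upwards [self_mem_nhdsWithin] with ρ hρ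
      have hρ : 0 < ρ := hρ
      rw [mem_closedBall, dist_eq_norm, sub_sub_cancel, norm_smul, Real.norm_of_nonneg (by positivity)]
      apply le_of_eq; ring)
  have hev := hlim.eventually_ne (one_ne_zero)
  have hsmall : Tendsto (fun ρ : ℝ => ρ * (R * ‖v‖ + 2)) (nhdsWithin 0 (Ioi 0)) (nhds 0) := by
    have : Continuous (fun ρ : ℝ => ρ * (R * ‖v‖ + 2)) := by fun_prop
    have h := this.tendsto 0
    simp only [zero_mul] at h
    exact h.mono_left nhdsWithin_le_nhds
  have hev2 := hev.and (hsmall.eventually_lt_const (show (0 : ℝ) < 1 / ((N : ℝ) + 1) by positivity))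
  rw [eventually_nhdsWithin_iff, Metric.eventually_nhds_iff] at hev2
  obtain ⟨δ, hδ, hev2⟩ := hev2
  right
  refine ⟨((N : ℝ) + 1) * (2 * (R * ‖v‖ + 2)), ?_⟩
  rw [Filter.eventually_map, eventually_nhdsWithin_iff, Metric.eventually_nhds_iff]
  refine ⟨δ, hδ, ?_⟩
  rintro y hyx ⟨hyE, hyne⟩
  have hρ : 0 < ‖y - x‖ := norm_pos_iff.2 (sub_ne_zero.2 hyne)
  rw [div_le_iff₀ hρ]
  obtain ⟨h1, h2⟩ := hev2 (y := ‖y - x‖) (by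
    rw [dist_zero_right, norm_norm, ← dist_eq_norm]; exact hyx) hρ
  set ρ := ‖y - x‖ with hρdef
  have hz : (A ∩ closedBall (x - (R * ρ) • v) ρ).Nonempty := by
    by_contra hcon
    rw [not_nonempty_iff_eq_empty] at hcon
    simp [hcon] at h1
  obtain ⟨z, hzA, hzb⟩ := hz
  have hstep : ∀ p ∈ goodSet f, ∀ e : E2, p = z + (R * ρ) • v + e → ‖e‖ ≤ 2 * ρ →
      |f p - f z| ≤ ((N : ℝ) + 1) * (ρ * (R * ‖v‖ + 2)) := by
    intro p hp e hpe he
    have hRρ : 0 < R * ρ := by positivity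
    have hpe' : p = z + (R * ρ) • (v + (R * ρ)⁻¹ • e) := by
      rw [hpe, smul_add, smul_smul, mul_inv_cancel₀ hRρ.ne', one_smul, add_assoc]
    have hmem : v + (R * ρ)⁻¹ • e ∈ O := by
      apply hrO
      rw [mem_ball, dist_eq_norm, add_sub_cancel_left, norm_smul, norm_inv,
        Real.norm_of_nonneg hRρ.le, inv_mul_lt_iff₀ hRρ]
      have : R * ρ * r = 3 * ρ := by rw [hR]; field_simp
      linarith
    have hnorm : (R * ρ) * ‖v + (R * ρ)⁻¹ • e‖ ≤ ρ * (R * ‖v‖ + 2) := by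
      have : (R * ρ) * ‖v + (R * ρ)⁻¹ • e‖ = ‖(R * ρ) • v + e‖ := by
        rw [← Real.norm_of_nonneg hRρ.le, ← norm_smul, Real.norm_of_nonneg hRρ.le, smul_add,
          smul_smul, mul_inv_cancel₀ hRρ.ne', one_smul]
      rw [this]
      refine (norm_add_le _ _).trans ?_
      rw [norm_smul, Real.norm_of_nonneg hRρ.le]
      linarith
    have := hzA.2 _ hmem (R * ρ) hRρ (by rw [← hpe']; exact hp) (by linarith)
    rw [← hpe'] at this
    exact this.trans (mul_le_mul_of_nonneg_left hnorm (by positivity))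
  rw [mem_closedBall, dist_eq_norm, ← norm_neg] at hzb
  have hx1 := hstep x hxA.1 (-(z - (x - (R * ρ) • v))) (by abel) (by linarith)
  have hy1 := hstep y hyE (-(z - (x - (R * ρ) • v)) + (y - x)) (by abel)
    ((norm_add_le _ _).trans (by linarith))
  have h5 := abs_sub_le (f y) (f z) (f x)
  rw [abs_sub_comm (f z) (f x)] at h5
  linarith

/-- If `E` is the set of points at which `f` is Lipschitz in every unit direction, then the set
of points of `E` at which `f` is not Lipschitz relative to `E` is Lebesgue null. -/
theorem stmt1 (f : E2 → ℝ) :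
    volume {x : E2 | x ∈ {x' : E2 | ∀ u ∈ Metric.sphere (0 : E2) 1, LipAtInDir f x' u} ∧
      ¬ LipAtRel f x {x' : E2 | ∀ u ∈ Metric.sphere (0 : E2) 1, LipAtInDir f x' u}} = 0 := by
  have hsub : {x : E2 | x ∈ goodSet f ∧ ¬ LipAtRel f x (goodSet f)} ⊆
      ⋃ O ∈ {O ∈ TopologicalSpace.countableBasis E2 | O.Nonempty}, ⋃ N : ℕ,
        (coneSet f O N ∩ {x | ¬ LipAtRel f x (goodSet f)}) := by
    rintro x ⟨hx, hxn⟩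
    obtain ⟨O, hO, N, hN⟩ := goodSet_cover hx
    simp only [mem_iUnion]
    exact ⟨O, ⟨hO, TopologicalSpace.nonempty_of_mem_countableBasis hO⟩, N, hN, hxn⟩
  refine measure_mono_null hsub ?_
  rw [measure_biUnion_null_iff ((TopologicalSpace.countable_countableBasis E2).mono (sep_subset _ _))]
  rintro O ⟨hO, hne⟩
  exact measure_iUnion_null fun N =>
    null_piece f O (TopologicalSpace.isOpen_of_mem_countableBasis hO) hne N
end
end

section
/- There exist sets Z ⊆ ℝ² and E ⊆ ℝ² such that the Lebesgue measure of ℝ² \ E is zero, the characteristic function χ_Z of Z is, at each point of E, differentiable in almost every direction, and χ_Z is at no point x ∈ ℝ² continuous relative to E (i.e., for every x ∈ ℝ² there exists a sequence y_i ∈ E with y_i → x and χ_Z(y_i) not converging to χ_Z(x)). -/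
open Metric MeasureTheory Filter Set

noncomputable section

/-- `f` is differentiable at `x` in direction `u`: the one-sided limit
`lim_{h→0+} (f(x+hu)−f(x))/h` exists and is finite. -/
def DiffAtInDir (f : E2 → ℝ) (x u : E2) : Prop :=
  ∃ L : ℝ, Filter.Tendsto (fun h : ℝ => (f (x + h • u) - f x) / h)
    (nhdsWithin (0 : ℝ) (Set.Ioi 0)) (nhds L)

/-- `f` is differentiable at `x` in almost every direction: the set of unit directions in which
it fails to be differentiable at `x` has zero one-dimensional Hausdorff measure. -/
def DiffAEDirs (f : E2 → ℝ) (x : E2) : Prop :=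
  MeasureTheory.Measure.hausdorffMeasure 1
    {u : E2 | u ∈ Metric.sphere (0 : E2) 1 ∧ ¬ DiffAtInDir f x u} = 0

namespace StmtThree

/-- The centres of the balls. -/
def ctr (j : ℕ) : E2 := TopologicalSpace.denseSeq E2 (Nat.unpair (j / 2)).1

/-- The `j`-th ball. -/
def bal (j : ℕ) : Set E2 := Metric.ball (ctr j) ((1 / 4 : ℝ) ^ j)

/-- Points whose last ball has even index. -/
def ZZ : Set E2 := {x | ∃ j, j % 2 = 0 ∧ x ∈ bal j ∧ ∀ i, j < i → x ∉ bal i}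

/-- The good points. -/
def EE : Set E2 := {x | (∀ j, x ∉ Metric.sphere (ctr j) ((1 / 4 : ℝ) ^ j)) ∧
  ∀ᶠ j in atTop, x ∉ Metric.ball (ctr j) ((1 / 2 : ℝ) ^ j)}

lemma vol_ball (c : E2) {r : ℝ} (hr : 0 ≤ r) :
    volume (Metric.ball c r) = ENNReal.ofReal (r ^ 2) * volume (Metric.ball (0 : E2) 1) := by
  have := Measure.addHaar_ball (volume : Measure E2) c hr
  simpa using this

lemma exists_ctr (U : Set E2) (hU : IsOpen U) (hne : U.Nonempty) (b N : ℕ) (hb : b < 2) :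
    ∃ j, N ≤ j ∧ j % 2 = b ∧ ctr j ∈ U := by
  obtain ⟨m, hm⟩ := (TopologicalSpace.denseRange_denseSeq E2).exists_mem_open hU hne
  refine ⟨2 * Nat.pair m N + b, ?_, by omega, ?_⟩
  · have := Nat.right_le_pair m N
    omega
  · have : (2 * Nat.pair m N + b) / 2 = Nat.pair m N := by omega
    simpa [ctr, this] using hm

lemma EE_null : volume (Set.univ \ EE) = 0 := by
  have h1 : volume (⋃ j, Metric.sphere (ctr j) ((1 / 4 : ℝ) ^ j)) = 0 := by
    rw [measure_iUnion_null_iff]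
    intro j
    exact Measure.addHaar_sphere _ _ _
  have h2 : volume {x | ∃ᶠ j in atTop, x ∈ Metric.ball (ctr j) ((1 / 2 : ℝ) ^ j)} = 0 := by
    apply measure_setOfPred_frequently_eq_zero
    have : ∀ j, volume (Metric.ball (ctr j) ((1 / 2 : ℝ) ^ j))
        = ENNReal.ofReal ((1 / 4 : ℝ) ^ j) * volume (Metric.ball (0 : E2) 1) := by
      intro j
      rw [vol_ball _ (by positivity), ← pow_mul, mul_comm j 2, pow_mul]
      norm_num
    change ∑' j, volume (Metric.ball (ctr j) ((1 / 2 : ℝ) ^ j)) ≠ ⊤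
    simp_rw [this]
    rw [ENNReal.tsum_mul_right]
    apply ENNReal.mul_ne_top _ measure_ball_lt_top.ne
    rw [← ENNReal.ofReal_tsum_of_nonneg (fun j => by positivity)
      (summable_geometric_of_lt_one (by norm_num) (by norm_num))]
    exact ENNReal.ofReal_ne_top
  refine measure_mono_null ?_ (measure_union_null h1 h2)
  rintro x ⟨-, hx⟩
  by_contra hc
  apply hx
  simp only [mem_union, mem_iUnion, mem_ofPred_eq, not_or, not_exists, not_frequently] at hc
  exact hc

lemma exists_last (x : E2) (ε : ℝ) (hε : 0 < ε) (b : ℕ) (hb : b < 2) :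
    ∃ y ∈ EE, dist y x < ε ∧ ∃ j, j % 2 = b ∧ y ∈ bal j ∧ ∀ i, j < i → y ∉ bal i := by
  obtain ⟨N, hN⟩ := exists_pow_lt_of_lt_one (half_pos hε) (show (1 / 4 : ℝ) < 1 by norm_num)
  obtain ⟨j, hj, hjb, hjc⟩ := exists_ctr (Metric.ball x (ε / 2)) Metric.isOpen_ball
    ⟨x, Metric.mem_ball_self (half_pos hε)⟩ b N hb
  have hr : (1 / 4 : ℝ) ^ j < ε / 2 :=
    lt_of_le_of_lt (pow_le_pow_of_le_one (by norm_num) (by norm_num) hj) hN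
  have hV0 : volume (Metric.ball (0 : E2) 1) ≠ 0 := (measure_ball_pos _ _ one_pos).ne'
  have hVt : volume (Metric.ball (0 : E2) 1) ≠ ⊤ := measure_ball_lt_top.ne
  have hvol : ∀ i, volume (bal i)
      = ENNReal.ofReal ((1 / 16 : ℝ) ^ i) * volume (Metric.ball (0 : E2) 1) := by
    intro i
    rw [bal, vol_ball _ (by positivity), ← pow_mul, mul_comm i 2, pow_mul]
    norm_num
  have hlt : volume ((⋃ i, bal (j + 1 + i)) ∪ (Set.univ \ EE)) < volume (bal j) := by
    refine lt_of_le_of_lt (measure_union_le _ _) ?_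
    rw [EE_null, add_zero]
    refine lt_of_le_of_lt (measure_iUnion_le _) ?_
    simp_rw [hvol]
    rw [ENNReal.tsum_mul_right]
    apply ENNReal.mul_lt_mul_left hV0 hVt
    rw [← ENNReal.ofReal_tsum_of_nonneg (fun j => by positivity)]
    · simp_rw [pow_add _ (j + 1)]
      rw [tsum_mul_left, tsum_geometric_of_lt_one (by norm_num) (by norm_num)]
      apply (ENNReal.ofReal_lt_ofReal_iff (by positivity)).2
      rw [pow_succ]
      have : (0 : ℝ) < (1 / 16) ^ j := by positivity
      have h2 : (1 - 1 / 16 : ℝ)⁻¹ = 16 / 15 := by norm_num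
      rw [h2]
      linarith
    · simp_rw [pow_add _ (j + 1)]
      exact (summable_geometric_of_lt_one (by norm_num) (by norm_num)).mul_left _
  have hns : ¬ bal j ⊆ ((⋃ i, bal (j + 1 + i)) ∪ (Set.univ \ EE)) :=
    fun h => absurd (measure_mono h) (not_le.2 hlt)
  obtain ⟨y, hy, hyn⟩ := Set.not_subset.1 hns
  simp only [mem_union, mem_iUnion, Set.mem_sdiff, mem_univ, true_and, not_or, not_exists,
    not_not] at hyn
  refine ⟨y, hyn.2, ?_, j, hjb, hy, ?_⟩
  · have h1 : dist y (ctr j) < (1 / 4 : ℝ) ^ j := hy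
    have h2 : dist (ctr j) x < ε / 2 := hjc
    linarith [dist_triangle y (ctr j) x]
  · intro i hi
    obtain ⟨k, rfl⟩ := Nat.exists_eq_add_of_le (Nat.succ_le_of_lt hi)
    exact hyn.1 k

lemma mem_ZZ_iff {y : E2} {j : ℕ} (hy : y ∈ bal j) (hl : ∀ i, j < i → y ∉ bal i) :
    y ∈ ZZ ↔ j % 2 = 0 := by
  constructor
  · rintro ⟨k, hk, hyk, hlk⟩
    have : k = j := by
      rcases lt_trichotomy k j with h | h | h
      · exact absurd hy (hlk _ h)
      · exact h
      · exact absurd hyk (hl _ h)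
    exact this ▸ hk
  · exact fun h => ⟨j, h, hy, hl⟩

lemma dir_close {x u p : E2} (hu : ‖u‖ = 1) {h r : ℝ} (hh : 0 < h) (hd : 0 < ‖p - x‖)
    (hm : ‖x + h • u - p‖ < r) : ‖u - ‖p - x‖⁻¹ • (p - x)‖ ≤ 2 * r / ‖p - x‖ := by
  set d := ‖p - x‖ with hdd
  have e1 : h • u - (p - x) = x + h • u - p := by abel
  have h1 : |h - d| < r := by
    have := abs_norm_sub_norm_le (h • u) (p - x)
    rw [e1, norm_smul, hu, mul_one, Real.norm_eq_abs, abs_of_pos hh] at this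
    linarith
  have e2 : u - d⁻¹ • (p - x) = d⁻¹ • ((d - h) • u + (x + h • u - p)) := by
    rw [← e1]
    have : d⁻¹ • (d • u) = u := by rw [smul_smul, inv_mul_cancel₀ hd.ne', one_smul]
    rw [sub_smul, show d • u - h • u + (h • u - (p - x)) = d • u - (p - x) by abel,
      smul_sub d⁻¹ (d • u), this]
  rw [e2, norm_smul, norm_inv, Real.norm_eq_abs, abs_of_pos hd, div_eq_inv_mul]
  gcongr
  refine (norm_add_le _ _).trans ?_
  rw [norm_smul, hu, mul_one, Real.norm_eq_abs, abs_sub_comm]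
  linarith

/-- Normalised direction from `x` to the `j`-th centre. -/
def dirv (x : E2) (j : ℕ) : E2 := ‖ctr j - x‖⁻¹ • (ctr j - x)

lemma good_dir {x : E2} (hx : x ∈ EE) {u : E2} (hu : ‖u‖ = 1)
    (hg : ∀ᶠ j in atTop, u ∉ Metric.closedBall (dirv x j) (2 * (1 / 2 : ℝ) ^ j)) :
    DiffAtInDir (Set.indicator ZZ (fun _ => (1 : ℝ))) x u := by
  obtain ⟨N, hN⟩ := eventually_atTop.1 (hg.and hx.2)
  have hbig : ∀ j, N ≤ j → x ∉ bal j ∧ ∀ h : ℝ, 0 < h → x + h • u ∉ bal j := by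
    intro j hj
    obtain ⟨h1, h2⟩ := hN j hj
    have h3 : (1 / 2 : ℝ) ^ j ≤ ‖ctr j - x‖ := by
      rw [Metric.mem_ball, not_lt, dist_comm, dist_eq_norm] at h2
      exact h2
    have hp : (0 : ℝ) < (1 / 2 : ℝ) ^ j := by positivity
    have h4 : (1 / 4 : ℝ) ^ j ≤ (1 / 2 : ℝ) ^ j := by gcongr; norm_num
    refine ⟨fun hb => h2 (Metric.ball_subset_ball h4 hb), fun h hh hb => h1 ?_⟩
    rw [bal, Metric.mem_ball, dist_eq_norm] at hb
    rw [Metric.mem_closedBall, dist_eq_norm]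
    refine (dir_close hu hh (hp.trans_le h3) hb).trans ?_
    rw [div_le_iff₀ (hp.trans_le h3)]
    have : (1 / 4 : ℝ) ^ j = (1 / 2) ^ j * (1 / 2) ^ j := by rw [← mul_pow]; norm_num
    rw [this]
    nlinarith
  have hcont : Tendsto (fun h : ℝ => x + h • u) (nhdsWithin 0 (Set.Ioi 0)) (nhds x) := by
    have : Tendsto (fun h : ℝ => x + h • u) (nhds 0) (nhds (x + (0 : ℝ) • u)) :=
      (by fun_prop : Continuous (fun h : ℝ => x + h • u)).tendsto 0
    rw [zero_smul, add_zero] at this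
    exact this.mono_left nhdsWithin_le_nhds
  have hsmall : ∀ᶠ h in nhdsWithin (0 : ℝ) (Set.Ioi 0), ∀ j ∈ Finset.range N,
      (x + h • u ∈ bal j ↔ x ∈ bal j) := by
    rw [Filter.eventually_all_finset]
    intro j _
    by_cases hb : x ∈ bal j
    · filter_upwards [hcont (Metric.isOpen_ball.mem_nhds hb)] with h hh
      exact ⟨fun _ => hb, fun _ => hh⟩
    · have hc : x ∈ (Metric.closedBall (ctr j) ((1 / 4 : ℝ) ^ j))ᶜ := by
        have h1 := hx.1 j
        rw [bal, Metric.mem_ball] at hb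
        rw [Metric.mem_sphere] at h1
        rw [mem_compl_iff, Metric.mem_closedBall]
        intro h2
        exact hb (lt_of_le_of_ne h2 h1)
      filter_upwards [hcont (Metric.isClosed_closedBall.isOpen_compl.mem_nhds hc)] with h hh
      exact ⟨fun h' => absurd (Metric.ball_subset_closedBall h') hh, fun h' => absurd h' hb⟩
  refine ⟨0, ?_⟩
  refine tendsto_const_nhds.congr' ?_
  filter_upwards [hsmall, self_mem_nhdsWithin] with h hh hpos
  have hall : ∀ j, (x + h • u ∈ bal j ↔ x ∈ bal j) := by
    intro j
    rcases lt_or_ge j N with hj | hj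
    · exact hh j (Finset.mem_range.2 hj)
    · exact iff_of_false ((hbig j hj).2 h hpos) (hbig j hj).1
  have hZ : x + h • u ∈ ZZ ↔ x ∈ ZZ := by
    simp only [ZZ, mem_ofPred_eq, hall]
  by_cases hxZ : x ∈ ZZ
  · rw [indicator_of_mem hxZ, indicator_of_mem (hZ.2 hxZ)]; simp
  · rw [indicator_of_notMem hxZ, indicator_of_notMem (fun h' => hxZ (hZ.1 h'))]; simp

lemma limsup_null (v : ℕ → E2) :
    Measure.hausdorffMeasure 1
      {u : E2 | ∃ᶠ j in atTop, u ∈ Metric.closedBall (v j) (2 * (1 / 2 : ℝ) ^ j)} = 0 := by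
  set S := {u : E2 | ∃ᶠ j in atTop, u ∈ Metric.closedBall (v j) (2 * (1 / 2 : ℝ) ^ j)} with hS
  have hdiam : ∀ j, ediam (Metric.closedBall (v j) (2 * (1 / 2 : ℝ) ^ j))
      ≤ ENNReal.ofReal (4 * (1 / 2 : ℝ) ^ j) := by
    intro j
    refine Metric.ediam_le fun a ha b hb => ?_
    rw [edist_dist]
    apply ENNReal.ofReal_le_ofReal
    rw [Metric.mem_closedBall] at ha hb
    linarith [dist_triangle_right a b (v j)]
  have h0 : Tendsto (fun n : ℕ => ENNReal.ofReal (4 * (1 / 2 : ℝ) ^ n)) atTop (nhds 0) := by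
    have : Tendsto (fun n : ℕ => 4 * (1 / 2 : ℝ) ^ n) atTop (nhds (4 * 0)) :=
      (tendsto_pow_atTop_nhds_zero_of_lt_one (by norm_num) (by norm_num)).const_mul _
    simpa using ENNReal.tendsto_ofReal this
  have key := Measure.hausdorffMeasure_le_liminf_tsum (X := E2) 1 S
    (l := atTop) (fun n : ℕ => ENNReal.ofReal (4 * (1 / 2 : ℝ) ^ n)) h0
    (fun n i : ℕ => Metric.closedBall (v (n + i)) (2 * (1 / 2 : ℝ) ^ (n + i)))
    (Eventually.of_forall fun n i => (hdiam _).trans (ENNReal.ofReal_le_ofReal (by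
      gcongr 4 * ?_
      exact pow_le_pow_of_le_one (by norm_num) (by norm_num) (by omega))))
    (Eventually.of_forall fun n u hu => by
      obtain ⟨j, hj, hju⟩ := (frequently_atTop.1 hu) n
      obtain ⟨i, rfl⟩ := Nat.exists_eq_add_of_le hj
      exact mem_iUnion.2 ⟨i, hju⟩)
  refine le_antisymm (key.trans ?_) bot_le
  have h8 : Tendsto (fun n : ℕ => ENNReal.ofReal (8 * (1 / 2 : ℝ) ^ n)) atTop (nhds 0) := by
    have : Tendsto (fun n : ℕ => 8 * (1 / 2 : ℝ) ^ n) atTop (nhds (8 * 0)) :=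
      (tendsto_pow_atTop_nhds_zero_of_lt_one (by norm_num) (by norm_num)).const_mul _
    simpa using ENNReal.tendsto_ofReal this
  rw [← h8.liminf_eq]
  apply liminf_le_liminf (Eventually.of_forall fun n => ?_)
  simp only [ENNReal.rpow_one]
  refine (ENNReal.tsum_le_tsum fun i => hdiam (n + i)).trans ?_
  rw [← ENNReal.ofReal_tsum_of_nonneg (fun j => by positivity)]
  · simp_rw [pow_add _ n, ← mul_assoc]
    rw [tsum_mul_left, tsum_geometric_of_lt_one (by norm_num) (by norm_num)]
    apply ENNReal.ofReal_le_ofReal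
    apply le_of_eq
    ring
  · simp_rw [pow_add _ n, ← mul_assoc]
    exact (summable_geometric_of_lt_one (by norm_num) (by norm_num)).mul_left _

end StmtThree

/-- There are sets `Z, E ⊆ ℝ²` with `|ℝ² \ E| = 0` such that `χ_Z` is differentiable in almost
every direction at every point of `E`, yet at no point `x ∈ ℝ²` is `χ_Z` continuous relative to
`E`: for every `x` there is a sequence `y_i ∈ E` with `y_i → x` and `χ_Z (y_i)` not converging
to `χ_Z x`. -/
theorem stmt3 : ∃ Z E : Set E2,
    volume (Set.univ \ E) = 0 ∧
    (∀ x ∈ E, DiffAEDirs (Set.indicator Z (fun _ => (1 : ℝ))) x) ∧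
    (∀ x : E2, ∃ y : ℕ → E2, (∀ i, y i ∈ E) ∧
      Filter.Tendsto y Filter.atTop (nhds x) ∧
      ¬ Filter.Tendsto (fun i => Set.indicator Z (fun _ => (1 : ℝ)) (y i)) Filter.atTop
        (nhds (Set.indicator Z (fun _ => (1 : ℝ)) x))) := by
  refine ⟨StmtThree.ZZ, StmtThree.EE, StmtThree.EE_null, ?_, ?_⟩
  · intro x hx
    refine measure_mono_null ?_ (StmtThree.limsup_null (StmtThree.dirv x))
    rintro u ⟨hu, hn⟩
    by_contra hc
    rw [mem_ofPred_eq, not_frequently] at hc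
    exact hn (StmtThree.good_dir hx (by simpa using hu) hc)
  · intro x
    have key : ∃ b : ℕ, b < 2 ∧ ¬ (b = 0 ↔ x ∈ StmtThree.ZZ) := by
      by_cases h : x ∈ StmtThree.ZZ
      · exact ⟨1, by norm_num, by simp [h]⟩
      · exact ⟨0, by norm_num, by simp [h]⟩
    obtain ⟨b, hb, hbx⟩ := key
    have hex := fun i : ℕ => StmtThree.exists_last x (1 / ((i : ℝ) + 1)) (by positivity) b hb
    choose y hyE hyd j hjb hyj hl using hex
    refine ⟨y, hyE, ?_, ?_⟩
    · rw [tendsto_iff_dist_tendsto_zero]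
      exact squeeze_zero (fun _ => dist_nonneg) (fun i => (hyd i).le)
        tendsto_one_div_add_atTop_nhds_zero_nat
    · have hy : ∀ i, y i ∈ StmtThree.ZZ ↔ b = 0 := fun i => by
        rw [StmtThree.mem_ZZ_iff (hyj i) (hl i), hjb i]
      intro ht
      by_cases h : x ∈ StmtThree.ZZ
      · have hb0 : b ≠ 0 := fun h' => hbx (iff_of_true h' h)
        have : ∀ i, Set.indicator StmtThree.ZZ (fun _ => (1 : ℝ)) (y i) = 0 := fun i =>
          indicator_of_notMem (fun h' => hb0 ((hy i).1 h')) _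
        simp only [this, indicator_of_mem h] at ht
        exact zero_ne_one (tendsto_nhds_unique tendsto_const_nhds ht)
      · have hb0 : b = 0 := by
          by_contra h'
          exact hbx (iff_of_false h' h)
        have : ∀ i, Set.indicator StmtThree.ZZ (fun _ => (1 : ℝ)) (y i) = 1 := fun i =>
          indicator_of_mem ((hy i).2 hb0) _
        simp only [this, indicator_of_notMem h] at ht
        exact one_ne_zero (tendsto_nhds_unique tendsto_const_nhds ht)
end
end
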